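/- Let n ≥ 1 and p ∈ [n]. Then, as subsets of S_{[n]}, â_{1,p}(n) = NC^{T,p}(n). -/

import Mathlib

open Equiv MeasureTheory ProbabilityTheory

noncomputable section

namespace RibbonNC

/-- The number of cycles `#(σ)` of a permutation, counted on the finite set `S`:
the number of orbits of `σ` meeting `S` (fixed points count as orbits). -/
def cyclesOn {α : Type*} (σ : Equiv.Perm α) (S : Finset α) : ℕ :=
  ((fun a => {b | σ.SameCycle a b}) '' (S : Set α)).ncard

/-- `σ` is a permutation of `S`: it fixes everything outside `S`. -/
def IsPermOn {α : Type*} (σ : Equiv.Perm α) (S : Finset α) : Prop :=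
  ∀ a ∉ S, σ a = a

/-- `σ` is a pairing of `S`: a fixed-point-free involution of `S`, fixing everything
outside `S`. -/
def IsPairingOn {α : Type*} (σ : Equiv.Perm α) (S : Finset α) : Prop :=
  σ * σ = 1 ∧ (∀ a ∈ S, σ a ≠ a) ∧ IsPermOn σ S

/-- `π` is non-crossing with respect to `γ` on `S`: the subgroup generated by `π` and `γ`
acts transitively on `S`, and `#(π) + #(π⁻¹γ) + #(γ) = |S| + 2`. -/
def IsNoncrossingOn {α : Type*} (π γ : Equiv.Perm α) (S : Finset α) : Prop :=
  (∀ a ∈ S, ∀ b ∈ S, ∃ σ ∈ Subgroup.closure ({π, γ} : Set (Equiv.Perm α)), σ a = b) ∧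
  cyclesOn π S + cyclesOn (π⁻¹ * γ) S + cyclesOn γ S = S.card + 2

/-- `[n] = {1, …, n}`, as a finset of integers. -/
def posSet (n : ℕ) : Finset ℤ := Finset.Icc 1 (n : ℤ)

/-- `±[n] = {−n, …, −1} ∪ {1, …, n}`, as a finset of integers. -/
def pmSet (n : ℕ) : Finset ℤ := Finset.Icc (-(n : ℤ)) (n : ℤ) \ {0}

/-- The cyclic permutation `γ_n = (1, 2, …, n)` of `[n]`. -/
def gammaZ (n : ℕ) : Equiv.Perm ℤ := ((List.range n).map fun i => ((i : ℤ) + 1)).formPerm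

/-- The permutation `γ̃_n = (1, 2, …, n)(−n, …, −2, −1)` of `±[n]`. -/
def gammaTildeZ (n : ℕ) : Equiv.Perm ℤ :=
  gammaZ n * ((List.range n).map fun i => ((i : ℤ) - (n : ℤ))).formPerm

/-- The involution `τ₀ : a ↦ −a` on `±[n]`, fixing everything outside. -/
def tau0 (n : ℕ) : Equiv.Perm ℤ :=
  ((List.range n).map fun i => Equiv.swap ((i : ℤ) + 1) (-((i : ℤ) + 1))).prod

/-- The involution `τ₂` on `±[n]`, pairing `−k` with `k+1` for `1 ≤ k ≤ n−1`, and `−n`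
with `1`. -/
def tau2 (n : ℕ) : Equiv.Perm ℤ :=
  ((List.range (n - 1)).map fun i => Equiv.swap (-((i : ℤ) + 1)) ((i : ℤ) + 2)).prod *
    Equiv.swap (-(n : ℤ)) 1

/-- The `δ`-condition for a permutation of `S = ±[n]`: no cycle of the form `(r, −r)`,
and together with every cycle `(r₁, …, r_s)`, the cycle `(−r_s, …, −r₁)` also occurs
(the latter is equivalent to `π(−a) = −π⁻¹(a)` for all `a`). -/
def IsDeltaOn (π : Equiv.Perm ℤ) (S : Finset ℤ) : Prop :=
  (∀ r ∈ S, ¬(π r = -r ∧ π (-r) = r)) ∧ ∀ a : ℤ, π (-a) = -(π⁻¹ a)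

/-- `a_g(n) = {π ∈ P₂(n) : #(π⁻¹γ_n) = n/2 + 1 − 2g}`. -/
def aSet (g n : ℕ) : Set (Equiv.Perm ℤ) :=
  {π | IsPairingOn π (posSet n) ∧ cyclesOn (π⁻¹ * gammaZ n) (posSet n) + 2 * g = n / 2 + 1}

/-- `b_k(n)`. -/
def bSet (k n : ℕ) : Set (Equiv.Perm ℤ) :=
  {τ₁ | IsPairingOn τ₁ (pmSet n) ∧ cyclesOn (tau2 n * τ₁) (pmSet n) + 2 * k = n + 2 ∧
    tau0 n * τ₁ = τ₁ * tau0 n ∧ (∀ a ∈ pmSet n, (tau0 n * τ₁) a ≠ a) ∧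
    ∃ a ∈ posSet n, τ₁ a ∈ posSet n}

/-- `NC₂^δ(n, −n)`, the symmetric non-crossing annular pairings of `±[n]`. -/
def ncDelta2 (n : ℕ) : Set (Equiv.Perm ℤ) :=
  {π | IsPairingOn π (pmSet n) ∧ IsNoncrossingOn π (gammaTildeZ n) (pmSet n) ∧
    IsDeltaOn π (pmSet n)}

/-- `γ_{n,u,v} = γ_n · (u−1, v)`, with `(0, v)` read as `(n, v)` when `u = 1`. -/
def gammaUV (n : ℕ) (u v : ℤ) : Equiv.Perm ℤ :=
  gammaZ n * Equiv.swap (if u = 1 then (n : ℤ) else u - 1) v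

/-- `NC₂^T_{u,v}(n)`. -/
def ncT2uv (n : ℕ) (u v : ℤ) : Set (Equiv.Perm ℤ) :=
  {π | IsPairingOn π (posSet n) ∧ IsNoncrossingOn π (gammaUV n u v) (posSet n) ∧
    π u = v ∧ ∀ a : ℤ, 1 ≤ a → a < u → π a ∈ posSet n ∧ ¬(u ≤ π a ∧ π a ≤ v)}

/-- `NC₂^T(n)`. -/
def ncT2 (n : ℕ) : Set (Equiv.Perm ℤ) :=
  {π | ∃ u v : ℤ, 1 ≤ u ∧ u < v ∧ v < (n : ℤ) ∧ π ∈ ncT2uv n u v}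

/-- `γ̃_{n,u,v} = γ̃_n · (−u, v−1) · (−v, u−1)`, with `(−v, 0)` read as `(−v, n)` when
`u = 1`. -/
def gammaTildeUV (n : ℕ) (u v : ℤ) : Equiv.Perm ℤ :=
  gammaTildeZ n * Equiv.swap (-u) (v - 1) *
    Equiv.swap (-v) (if u = 1 then (n : ℤ) else u - 1)

/-- `NC₂^K_{u,v}(n)`. -/
def ncK2uv (n : ℕ) (u v : ℤ) : Set (Equiv.Perm ℤ) :=
  {π | IsPairingOn π (pmSet n) ∧ IsNoncrossingOn π (gammaTildeUV n u v) (pmSet n) ∧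
    IsDeltaOn π (pmSet n) ∧ π u = -v ∧ ∀ a : ℤ, 1 ≤ a → a < u → π a ∈ posSet n}

/-- `NC₂^K(n)`. -/
def ncK2 (n : ℕ) : Set (Equiv.Perm ℤ) :=
  {π | ∃ u v : ℤ, 1 ≤ u ∧ u < v ∧ v < (n : ℤ) ∧ π ∈ ncK2uv n u v}

/-- The odd elements `{1, 3, …, 2n−1}` of `[2n]`. -/
def oddPosSet (n : ℕ) : Finset ℤ := (posSet (2 * n)).filter fun a => Odd a

/-- `ã_{g,p}(n)`. -/
def aTildeSet (g p n : ℕ) : Set (Equiv.Perm ℤ) :=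
  {π | π ∈ aSet g (2 * n) ∧ (∀ a ∈ posSet (2 * n), Even a → Odd (π a)) ∧
    cyclesOn (π⁻¹ * gammaZ (2 * n)) (oddPosSet n) = p}

/-- `B(n) = {1, 3, …, 2n−1} ∪ {−2, −4, …, −2n} ⊂ ±[2n]`. -/
def BSet (n : ℕ) : Finset ℤ :=
  (pmSet (2 * n)).filter fun a => (0 < a ∧ Odd a) ∨ (a < 0 ∧ Even a)

/-- `W(n) = {2, 4, …, 2n} ∪ {−1, −3, …, −(2n−1)} ⊂ ±[2n]`. -/
def WSet (n : ℕ) : Finset ℤ :=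
  (pmSet (2 * n)).filter fun a => (0 < a ∧ Even a) ∨ (a < 0 ∧ Odd a)

/-- `b̃_{k,p}(n)`. -/
def bTildeSet (k p n : ℕ) : Set (Equiv.Perm ℤ) :=
  {τ₁ | τ₁ ∈ bSet k (2 * n) ∧ (∀ a ∈ BSet n, τ₁ a ∈ BSet n) ∧
    cyclesOn (tau2 (2 * n) * τ₁) (WSet n) = 2 * p}

/-- `â_{g,p}(n) = {π ∈ S_{[n]} : #(π) = p, #(π⁻¹γ_n) = n − p + 1 − 2g}`. -/
def aHatSet (g p n : ℕ) : Set (Equiv.Perm ℤ) :=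
  {π | IsPermOn π (posSet n) ∧ cyclesOn π (posSet n) = p ∧
    cyclesOn (π⁻¹ * gammaZ n) (posSet n) + p + 2 * g = n + 1}

/-- `b̂_{k,p}(n)`. -/
def bHatSet (k p n : ℕ) : Set (Equiv.Perm ℤ) :=
  {τ₁ | IsPermOn τ₁ (pmSet n) ∧ cyclesOn τ₁ (pmSet n) = 2 * p ∧
    cyclesOn (gammaTildeZ n * τ₁) (pmSet n) + 2 * p + 2 * k = 2 * n + 2 ∧
    tau0 n * τ₁ * tau0 n = τ₁⁻¹ ∧ (∀ a ∈ pmSet n, (tau0 n * τ₁) a ≠ a) ∧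
    ∃ a ∈ posSet n, -(τ₁ a) ∈ posSet n}

/-- `ÑC₂^{δ,p}(2n, −2n)`. -/
def ncDelta2Tilde (p n : ℕ) : Set (Equiv.Perm ℤ) :=
  {π | π ∈ ncDelta2 (2 * n) ∧ (∀ a ∈ WSet n, π a ∈ BSet n) ∧
    cyclesOn (π⁻¹ * gammaTildeZ (2 * n)) (BSet n) = 2 * p}

/-- `ÑC₂^{T,p}(2n)`. -/
def ncT2Tilde (p n : ℕ) : Set (Equiv.Perm ℤ) :=
  {π | ∃ u v : ℤ, 1 ≤ u ∧ u < v ∧ v < (2 * n : ℤ) ∧ Odd (v - u) ∧ π ∈ ncT2uv (2 * n) u v ∧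
    (∀ a ∈ posSet (2 * n), Even a → Odd (π a)) ∧
    cyclesOn (π⁻¹ * gammaZ (2 * n)) (oddPosSet n) = p}

/-- `ÑC₂^{K,p}(2n)`. -/
def ncK2Tilde (p n : ℕ) : Set (Equiv.Perm ℤ) :=
  {π | ∃ u v : ℤ, 1 ≤ u ∧ u < v ∧ v < (2 * n : ℤ) ∧ Even (v - u) ∧ π ∈ ncK2uv (2 * n) u v ∧
    (∀ a ∈ WSet n, π a ∈ BSet n) ∧
    cyclesOn (π⁻¹ * gammaTildeZ (2 * n)) (BSet n) = 2 * p}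

/-- `NC^{T,p}(n)` (non-crossing annular permutations, toroidal case). -/
def ncTPerm (p n : ℕ) : Set (Equiv.Perm ℤ) :=
  {π | ∃ u v : ℤ, 1 ≤ u ∧ u < v ∧ v < (n : ℤ) ∧ IsPermOn π (posSet n) ∧
    IsNoncrossingOn π (gammaUV n u v) (posSet n) ∧ π⁻¹ u = v ∧
    cyclesOn π (posSet n) = p ∧
    ∀ a : ℤ, 1 ≤ a → a < u → π⁻¹ a ∈ posSet n ∧ ¬(u ≤ π⁻¹ a ∧ π⁻¹ a ≤ v)}

/-- `NC^{δ,p}(n, −n)` (symmetric non-crossing annular permutations). -/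
def ncDeltaPerm (p n : ℕ) : Set (Equiv.Perm ℤ) :=
  {π | IsPermOn π (pmSet n) ∧ IsNoncrossingOn π (gammaTildeZ n) (pmSet n) ∧
    IsDeltaOn π (pmSet n) ∧ cyclesOn π (pmSet n) = 2 * p}

/-- `NC^{K,p}(n)` (non-crossing annular permutations, Klein bottle case). -/
def ncKPerm (p n : ℕ) : Set (Equiv.Perm ℤ) :=
  {π | ∃ u v : ℤ, 1 ≤ u ∧ u < v ∧ v < (n : ℤ) ∧ IsPermOn π (pmSet n) ∧
    IsNoncrossingOn π (gammaTildeUV n u v) (pmSet n) ∧ IsDeltaOn π (pmSet n) ∧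
    π u = -v ∧ cyclesOn π (pmSet n) = 2 * p ∧
    ∀ a : ℤ, 1 ≤ a → a < u → π⁻¹ a ∈ posSet n}


theorem p_apply_inv {α : Type*} (σ : Equiv.Perm α) (a : α) : σ (σ⁻¹ a) = a :=
  Equiv.apply_symm_apply σ a

theorem p_inv_apply {α : Type*} (σ : Equiv.Perm α) (a : α) : σ⁻¹ (σ a) = a :=
  Equiv.symm_apply_apply σ a

theorem sc_apply {α : Type*} (σ : Equiv.Perm α) (a : α) : σ.SameCycle a (σ a) := ⟨1, by simp⟩

theorem pow_agree {α : Type*} [DecidableEq α] (σ : Equiv.Perm α) (x y a : α) (k : ℕ)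
    (h : ∀ j < k, (σ ^ j) a ≠ x ∧ (σ ^ j) a ≠ y) :
    ((σ * Equiv.swap x y) ^ k) a = (σ ^ k) a := by
  induction k with
  | zero => simp
  | succ k ih =>
    rw [pow_succ', pow_succ', Equiv.Perm.mul_apply, Equiv.Perm.mul_apply,
      ih (fun j hj => h j (by omega)), Equiv.Perm.mul_apply,
      Equiv.swap_apply_of_ne_of_ne (h k (by omega)).1 (h k (by omega)).2]

theorem sc_nat {α : Type*} (σ : Equiv.Perm α) (S : Finset α) (hσ : IsPermOn σ S) {a b : α}
    (h : σ.SameCycle a b) : ∃ k : ℕ, (σ ^ k) a = b := by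
  classical
  by_cases ha : σ a = a
  · refine ⟨0, ?_⟩
    obtain ⟨i, hi⟩ := h
    rw [← hi]
    simp [Equiv.Perm.zpow_apply_eq_self_of_apply_eq_self ha]
  · -- finite support
    have hfin : Set.Finite {x | σ.SameCycle a x} := by
      apply (S.finite_toSet).subset
      intro x hx
      by_contra hxS
      have h1 : σ x = x := hσ x hxS
      exact ha ((Equiv.Perm.SameCycle.apply_eq_self_iff hx).2 h1)
    have hinj : ¬ Function.Injective (fun k : ℕ => (σ ^ k) a) := by
      intro hi
      have : Set.Infinite (Set.range (fun k : ℕ => (σ ^ k) a)) := Set.infinite_range_of_injective hi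
      apply this
      apply hfin.subset
      rintro _ ⟨k, rfl⟩
      exact ⟨k, by simp⟩
    have hper : ∃ m : ℕ, 0 < m ∧ (σ ^ m) a = a := by
      rw [Function.Injective] at hinj
      push Not at hinj
      obtain ⟨i, j, hij, hne⟩ := hinj
      have key : ∀ i j : ℕ, i < j → (σ ^ i) a = (σ ^ j) a → ∃ m : ℕ, 0 < m ∧ (σ ^ m) a = a := by
        intro i j hlt he
        refine ⟨j - i, by omega, ?_⟩
        have : (σ ^ j) a = (σ ^ i) ((σ ^ (j - i)) a) := by
          rw [← Equiv.Perm.mul_apply, ← pow_add]; congr 2; omega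
        rw [this] at he
        exact ((σ ^ i).injective he).symm
      rcases lt_or_gt_of_ne hne with h1 | h1
      · exact key i j h1 hij
      · exact key j i h1 hij.symm
    obtain ⟨m, hm, hma⟩ := hper
    obtain ⟨i, hi⟩ := h
    refine ⟨(i % m).toNat, ?_⟩
    have hz : (σ ^ (m : ℤ)) a = a := by simpa using hma
    have h0 : 0 ≤ i % (m : ℤ) := Int.emod_nonneg _ (by omega)
    have h2 : (σ ^ (i % m)) a = b := by
      rw [← hi]
      conv_rhs => rw [← Int.emod_add_mul_ediv i m, zpow_add, Equiv.Perm.mul_apply, zpow_mul,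
        Equiv.Perm.zpow_apply_eq_self_of_apply_eq_self hz]
    rw [← h2, ← zpow_natCast, Int.toNat_of_nonneg h0]

theorem merge_aux {α : Type*} [DecidableEq α] (σ : Equiv.Perm α) (S : Finset α)
    (hσ : IsPermOn σ S) (x y a : α) (hxy : ¬ σ.SameCycle x y) (h : σ.SameCycle a x) :
    (σ * Equiv.swap x y).SameCycle a x := by
  classical
  have hk := sc_nat σ S hσ h
  have hs := Nat.find_spec hk
  refine ⟨(Nat.find hk : ℕ), ?_⟩
  rw [zpow_natCast, pow_agree, hs]
  intro j hj
  refine ⟨Nat.find_min hk hj, ?_⟩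
  intro hy
  apply hxy
  refine h.symm.trans ⟨j, by simpa using hy⟩

theorem merge_xy {α : Type*} [DecidableEq α] (σ : Equiv.Perm α) (S : Finset α)
    (hσ : IsPermOn σ S) (x y : α) (hxy : ¬ σ.SameCycle x y) :
    (σ * Equiv.swap x y).SameCycle x y := by
  have h1 : (σ * Equiv.swap x y).SameCycle (σ x) x :=
    merge_aux σ S hσ x y _ hxy (sc_apply σ x).symm
  have h2 : (σ * Equiv.swap x y) y = σ x := by simp
  have h3 := sc_apply (σ * Equiv.swap x y) y
  rw [h2] at h3
  exact (h3.trans h1).symm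

theorem merge_in {α : Type*} [DecidableEq α] (σ : Equiv.Perm α) (S : Finset α)
    (hσ : IsPermOn σ S) (x y a : α) (hxy : ¬ σ.SameCycle x y)
    (h : σ.SameCycle a x ∨ σ.SameCycle a y) :
    (σ * Equiv.swap x y).SameCycle a x := by
  rcases h with h | h
  · exact merge_aux σ S hσ x y a hxy h
  · have := merge_aux σ S hσ y x a (fun h => hxy h.symm) h
    rw [Equiv.swap_comm] at this
    exact this.trans (merge_xy σ S hσ x y hxy).symm

theorem zpow_mem_of {α : Type*} (f g : Equiv.Perm α) (P : α → Prop)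
    (hfg : ∀ a, P a → f a = g a) (hP : ∀ a, P a ↔ P (g a)) (a : α) (ha : P a) (i : ℤ) :
    P ((g ^ i) a) ∧ (f ^ i) a = (g ^ i) a := by
  induction i using Int.induction_on with
  | zero => simpa using ha
  | succ i ih =>
    rw [add_comm, zpow_add, zpow_add, zpow_one, zpow_one, Equiv.Perm.mul_apply,
      Equiv.Perm.mul_apply, ih.2]
    exact ⟨(hP _).1 ih.1, hfg _ ih.1⟩
  | pred i ih =>
    have e : (-(i : ℤ) - 1) = -1 + -(i : ℤ) := by ring
    rw [e, zpow_add, zpow_add, zpow_neg_one, zpow_neg_one, Equiv.Perm.mul_apply,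
      Equiv.Perm.mul_apply, ih.2]
    have h1 : P (g⁻¹ ((g ^ (-(i : ℤ))) a)) := by
      rw [hP]; simpa using ih.1
    refine ⟨h1, ?_⟩
    rw [Equiv.Perm.inv_eq_iff_eq, hfg _ h1]
    simp

theorem sc_invariant {α : Type*} (g : Equiv.Perm α) (P : α → Prop)
    (hP : ∀ a, P a ↔ P (g a)) {a b : α} (h : g.SameCycle a b) (ha : P a) : P b := by
  obtain ⟨i, rfl⟩ := h
  exact (zpow_mem_of g g P (fun _ _ => rfl) hP a ha i).1

theorem merge_out {α : Type*} [DecidableEq α] (σ : Equiv.Perm α) (x y a b : α)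
    (h : ¬ (σ.SameCycle a x ∨ σ.SameCycle a y)) :
    (σ * Equiv.swap x y).SameCycle a b ↔ σ.SameCycle a b := by
  have key := zpow_mem_of (σ * Equiv.swap x y) σ
    (fun a => ¬ (σ.SameCycle a x ∨ σ.SameCycle a y))
    (by
      intro c hc
      push Not at hc
      rw [Equiv.Perm.mul_apply, Equiv.swap_apply_of_ne_of_ne]
      · rintro rfl; exact hc.1 (Equiv.Perm.SameCycle.refl _ _)
      · rintro rfl; exact hc.2 (Equiv.Perm.SameCycle.refl _ _))
    (by intro c; simp) a h
  constructor
  · rintro ⟨i, hi⟩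
    exact ⟨i, by rw [← (key i).2, hi]⟩
  · rintro ⟨i, hi⟩
    exact ⟨i, by rw [(key i).2, hi]⟩

theorem merge_iff {α : Type*} [DecidableEq α] (σ : Equiv.Perm α) (S : Finset α)
    (hσ : IsPermOn σ S) (x y a : α) (hxy : ¬ σ.SameCycle x y) :
    (σ * Equiv.swap x y).SameCycle x a ↔ (σ.SameCycle a x ∨ σ.SameCycle a y) := by
  constructor
  · intro h
    by_contra hc
    have := (merge_out σ x y a x hc).1 h.symm
    exact hc (Or.inl this)
  · intro h
    exact (merge_in σ S hσ x y a hxy h).symm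

theorem cyc_class_eq {α : Type*} (σ : Equiv.Perm α) (a b : α) :
    {c | σ.SameCycle a c} = {c | σ.SameCycle b c} ↔ σ.SameCycle a b := by
  constructor
  · intro h
    have : b ∈ {c | σ.SameCycle a c} := by rw [h]; exact Equiv.Perm.SameCycle.refl _ _
    exact this
  · intro h
    ext c
    exact ⟨fun h1 => h.symm.trans h1, fun h1 => h.trans h1⟩

theorem merge_count {α : Type*} [DecidableEq α] (σ : Equiv.Perm α) (S : Finset α)
    (hσ : IsPermOn σ S) (x y : α) (hx : x ∈ S) (hy : y ∈ S) (hxy : ¬ σ.SameCycle x y) :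
    cyclesOn (σ * Equiv.swap x y) S + 1 = cyclesOn σ S := by
  classical
  set τ := σ * Equiv.swap x y with hτ
  set T : Set α := {a | a ∈ S ∧ ¬ (σ.SameCycle a x ∨ σ.SameCycle a y)} with hT
  set D := (fun a => {b | σ.SameCycle a b}) '' T with hD
  have hDfin : D.Finite := ((S.finite_toSet).subset (fun a ha => ha.1)).image _
  have e1 : (fun a => {b | τ.SameCycle a b}) '' (S : Set α) = insert {b | τ.SameCycle x b} D := by
    ext C
    simp only [Set.mem_image, Set.mem_insert_iff, hD]
    constructor
    · rintro ⟨a, ha, rfl⟩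
      by_cases hc : σ.SameCycle a x ∨ σ.SameCycle a y
      · left
        exact (cyc_class_eq τ a x).2 (merge_in σ S hσ x y a hxy hc)
      · right
        refine ⟨a, ⟨ha, hc⟩, ?_⟩
        ext b
        exact (merge_out σ x y a b hc).symm
    · rintro (rfl | ⟨a, ⟨ha, hc⟩, rfl⟩)
      · exact ⟨x, hx, rfl⟩
      · refine ⟨a, ha, ?_⟩
        ext b
        exact (merge_out σ x y a b hc)
  have e2 : (fun a => {b | σ.SameCycle a b}) '' (S : Set α) =
      insert {b | σ.SameCycle x b} (insert {b | σ.SameCycle y b} D) := by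
    ext C
    simp only [Set.mem_image, Set.mem_insert_iff, hD]
    constructor
    · rintro ⟨a, ha, rfl⟩
      by_cases hc : σ.SameCycle a x
      · left; exact (cyc_class_eq σ a x).2 hc
      by_cases hc' : σ.SameCycle a y
      · right; left; exact (cyc_class_eq σ a y).2 hc'
      right; right
      exact ⟨a, ⟨ha, by tauto⟩, rfl⟩
    · rintro (rfl | rfl | ⟨a, ⟨ha, hc⟩, rfl⟩)
      · exact ⟨x, hx, rfl⟩
      · exact ⟨y, hy, rfl⟩
      · exact ⟨a, ha, rfl⟩
  have n1 : {b | τ.SameCycle x b} ∉ D := by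
    rintro ⟨a, ⟨ha, hc⟩, he⟩
    have : x ∈ {b | τ.SameCycle x b} := Equiv.Perm.SameCycle.refl _ _
    rw [← he] at this
    exact hc (Or.inl this)
  have n2 : {b | σ.SameCycle y b} ∉ D := by
    rintro ⟨a, ⟨ha, hc⟩, he⟩
    exact hc (Or.inr ((cyc_class_eq σ a y).1 he))
  have n3 : {b | σ.SameCycle x b} ∉ insert {b | σ.SameCycle y b} D := by
    rintro (he | ⟨a, ⟨ha, hc⟩, he⟩)
    · exact hxy ((cyc_class_eq σ x y).1 he)
    · exact hc (Or.inl ((cyc_class_eq σ a x).1 he))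
  unfold cyclesOn
  rw [e1, e2, Set.ncard_insert_of_notMem n1 hDfin, Set.ncard_insert_of_notMem n3 (hDfin.insert _),
    Set.ncard_insert_of_notMem n2 hDfin]

theorem sc_fixed {α : Type*} (σ : Equiv.Perm α) {a b : α} (ha : σ a = a)
    (h : σ.SameCycle a b) : a = b := by
  obtain ⟨i, rfl⟩ := h
  exact (Equiv.Perm.zpow_apply_eq_self_of_apply_eq_self ha i).symm

theorem cycles_insert {α : Type*} [DecidableEq α] (σ : Equiv.Perm α) (S : Finset α) (x : α)
    (hx : x ∉ S) (hfix : σ x = x) : cyclesOn σ (insert x S) = cyclesOn σ S + 1 := by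
  unfold cyclesOn
  rw [Finset.coe_insert, Set.image_insert_eq, Set.ncard_insert_of_notMem]
  · rintro ⟨a, ha, he⟩
    have := (cyc_class_eq σ a x).1 he
    have := sc_fixed σ hfix this.symm
    subst this
    exact hx ha

theorem permOn_mul {α : Type*} {σ τ : Equiv.Perm α} {S : Finset α} (h1 : IsPermOn σ S)
    (h2 : IsPermOn τ S) : IsPermOn (σ * τ) S := by
  intro a ha
  rw [Equiv.Perm.mul_apply, h2 a ha, h1 a ha]

theorem permOn_inv {α : Type*} {σ : Equiv.Perm α} {S : Finset α} (h1 : IsPermOn σ S) :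
    IsPermOn σ⁻¹ S := by
  intro a ha
  rw [Equiv.Perm.inv_eq_iff_eq, h1 a ha]

theorem permOn_swap {α : Type*} [DecidableEq α] {x y : α} {S : Finset α} (hx : x ∈ S)
    (hy : y ∈ S) : IsPermOn (Equiv.swap x y) S := by
  intro a ha
  apply Equiv.swap_apply_of_ne_of_ne
  · rintro rfl; exact ha hx
  · rintro rfl; exact ha hy

theorem permOn_mem {α : Type*} {σ : Equiv.Perm α} {S : Finset α} (h1 : IsPermOn σ S) {a : α}
    (ha : a ∈ S) : σ a ∈ S := by
  by_contra hc
  have := h1 _ hc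
  have := σ.injective this
  rw [this] at hc
  exact hc ha

/-- A permutation mapping a finite set into itself maps the complement into itself. -/
theorem finite_inv {α : Type*} (σ : Equiv.Perm α) (S : Finset α) (h : ∀ a ∈ S, σ a ∈ S) (a : α) :
    a ∈ S ↔ σ a ∈ S := by
  classical
  refine ⟨h a, fun ha => ?_⟩
  have h1 : S.image σ = S := Finset.eq_of_subset_of_card_le
    (by intro b hb; obtain ⟨c, hc, rfl⟩ := Finset.mem_image.1 hb; exact h c hc)
    (by rw [Finset.card_image_of_injective _ σ.injective])
  rw [← h1] at ha
  obtain ⟨c, hc, he⟩ := Finset.mem_image.1 ha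
  rwa [← σ.injective he]

theorem mem_pos {n : ℕ} {a : ℤ} : a ∈ posSet n ↔ 1 ≤ a ∧ a ≤ n := by simp [posSet]

theorem gamma_def (n : ℕ) :
    gammaZ n = ((List.range n).map fun i : ℕ => ((i : ℤ) + 1)).formPerm := by
  unfold gammaZ
  congr 1
  simp [List.flatMap_singleton', List.map_eq_flatMap, List.flatMap_assoc]

theorem gamma_permOn (n : ℕ) : IsPermOn (gammaZ n) (posSet n) := by
  intro a ha
  rw [gamma_def]
  apply List.formPerm_apply_of_notMem
  intro h
  rw [List.mem_map] at h
  obtain ⟨i, hi, rfl⟩ := h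
  rw [List.mem_range] at hi
  exact ha (mem_pos.2 ⟨by omega, by omega⟩)

theorem gamma_nodup (n : ℕ) : ((List.range n).map fun i : ℕ => ((i : ℤ) + 1)).Nodup := by
  apply List.Nodup.map _ List.nodup_range
  intro a b h
  simpa using h

theorem gamma_lt (n : ℕ) (a : ℤ) (h1 : 1 ≤ a) (h2 : a < n) : gammaZ n a = a + 1 := by
  obtain ⟨k, rfl⟩ : ∃ k : ℕ, a = k + 1 := ⟨(a - 1).toNat, by omega⟩
  have := List.formPerm_apply_lt_getElem _ (gamma_nodup n) k (by simp; omega)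
  simpa [gamma_def] using this

theorem gamma_last (n : ℕ) (h : 1 ≤ n) : gammaZ n n = 1 := by
  have := List.formPerm_apply_getElem _ (gamma_nodup n) (n - 1) (by simp; omega)
  have e : ((n - 1 : ℕ) : ℤ) + 1 = n := by omega
  simp only [List.getElem_map, List.getElem_range, e, List.length_map, List.length_range] at this
  rw [gamma_def, this, Nat.sub_add_cancel h]
  simp

theorem gamma_succ (n : ℕ) (h : 1 ≤ n) :
    gammaZ (n + 1) = gammaZ n * Equiv.swap (n : ℤ) ((n : ℤ) + 1) := by
  ext a
  rw [Equiv.Perm.mul_apply]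
  by_cases h1 : a = n
  · subst h1
    rw [Equiv.swap_apply_left, gamma_lt _ _ (by omega) (by push_cast; omega),
      gamma_permOn n _ (by rw [mem_pos]; omega)]
  by_cases h2 : a = n + 1
  · subst h2
    rw [Equiv.swap_apply_right, gamma_last n h]
    exact_mod_cast gamma_last (n + 1) (by omega)
  rw [Equiv.swap_apply_of_ne_of_ne h1 h2]
  by_cases h3 : 1 ≤ a ∧ a < n
  · rw [gamma_lt _ _ h3.1 (by push_cast; omega), gamma_lt _ _ h3.1 h3.2]
  · rw [gamma_permOn n _ (by rw [mem_pos]; omega), gamma_permOn (n + 1) _ (by rw [mem_pos]; push_cast; omega)]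

theorem posSet_succ (n : ℕ) : posSet (n + 1) = insert ((n : ℤ) + 1) (posSet n) := by
  ext a
  rw [Finset.mem_insert, mem_pos, mem_pos]
  push_cast; omega

theorem permOn_mono {α : Type*} {σ : Equiv.Perm α} {S T : Finset α} (h : S ⊆ T)
    (h1 : IsPermOn σ S) : IsPermOn σ T := fun a ha => h1 a (fun hc => ha (h hc))

theorem pos_sub (n : ℕ) : posSet n ⊆ posSet (n + 1) := by
  rw [posSet_succ]; exact Finset.subset_insert _ _

/-- Count of `π⁻¹ γ_{n+1}` when `π` lives on `[n]`. -/
theorem cycles_step (n : ℕ) (h : 1 ≤ n) (ρ : Equiv.Perm ℤ) (hρ : IsPermOn ρ (posSet n)) :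
    cyclesOn (ρ * gammaZ (n + 1)) (posSet (n + 1)) = cyclesOn (ρ * gammaZ n) (posSet n) := by
  rw [gamma_succ n h, ← mul_assoc]
  have hP : IsPermOn (ρ * gammaZ n) (posSet n) := permOn_mul hρ (gamma_permOn n)
  have hnot : (n : ℤ) + 1 ∉ posSet n := by rw [mem_pos]; omega
  have := merge_count (ρ * gammaZ n) (posSet (n + 1)) (permOn_mono (pos_sub n) hP) n (n + 1)
    (by rw [mem_pos]; push_cast; omega) (by rw [mem_pos]; push_cast; omega)
    (fun hc => by have := sc_fixed _ (hP _ hnot) hc.symm; omega)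
  have h2 := cycles_insert (ρ * gammaZ n) (posSet n) _ hnot (hP _ hnot)
  rw [← posSet_succ] at h2
  omega

theorem gamma_cycles (n : ℕ) (h : 1 ≤ n) : cyclesOn (gammaZ n) (posSet n) = 1 := by
  induction n, h using Nat.le_induction with
  | base =>
    have : posSet 1 = {1} := by ext a; rw [mem_pos]; simp; omega
    rw [this]; simp [cyclesOn]
  | succ n hn ih =>
    have := cycles_step n hn 1 (fun _ _ => rfl)
    simpa [ih] using this

theorem planar (n : ℕ) (h : 1 ≤ n) : ∀ π : Equiv.Perm ℤ, IsPermOn π (posSet n) →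
    (∀ v : ℤ, 1 ≤ v → v ≤ n → π v ≤ v → ∀ a, π v ≤ a → a ≤ v → π v ≤ π a ∧ π a ≤ v) →
    cyclesOn π (posSet n) + cyclesOn (π⁻¹ * gammaZ n) (posSet n) = n + 1 := by
  induction n, h using Nat.le_induction with
  | base =>
    intro π hπ _
    have : posSet 1 = {1} := by ext a; rw [mem_pos]; simp; omega
    rw [this]; simp [cyclesOn]
  | succ n hn ih =>
    intro π hπ hC
    have hNn : (n : ℤ) + 1 ∉ posSet n := by rw [mem_pos]; omega
    -- case of a fixed last point
    have fixcase : ∀ ρ : Equiv.Perm ℤ, IsPermOn ρ (posSet (n + 1)) → ρ ((n : ℤ) + 1) = n + 1 →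
        (∀ v : ℤ, 1 ≤ v → v ≤ n → ρ v ≤ v → ∀ a, ρ v ≤ a → a ≤ v → ρ v ≤ ρ a ∧ ρ a ≤ v) →
        cyclesOn ρ (posSet (n + 1)) + cyclesOn (ρ⁻¹ * gammaZ (n + 1)) (posSet (n + 1)) = n + 2 := by
      intro ρ hρ hf hρC
      have hρ' : IsPermOn ρ (posSet n) := by
        intro a ha
        by_cases he : a = n + 1
        · rw [he, hf]
        · apply hρ
          rw [posSet_succ, Finset.mem_insert]; tauto
      have h1 := ih ρ hρ' hρC
      have h2 := cycles_step n hn ρ⁻¹ (permOn_inv hρ')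
      have h3 := cycles_insert ρ (posSet n) _ hNn hf
      rw [← posSet_succ] at h3
      omega
    by_cases hf : π ((n : ℤ) + 1) = n + 1
    · have := fixcase π hπ hf (fun v h1 h2 => hC v h1 (by push_cast; omega))
      omega
    have hNmem : (n : ℤ) + 1 ∈ posSet (n + 1) := by rw [mem_pos]; push_cast; omega
    obtain ⟨u, hu⟩ : ∃ u, u = π ((n : ℤ) + 1) := ⟨_, rfl⟩
    have humem : u ∈ posSet (n + 1) := by rw [hu]; exact permOn_mem hπ hNmem
    have hub := mem_pos.1 humem
    push_cast at hub
    have hun : u ≤ n := by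
      rcases lt_or_eq_of_le hub.2 with h | h
      · omega
      · exact absurd (hu.symm.trans h) hf
    obtain ⟨w, hw⟩ : ∃ w, w = π⁻¹ ((n : ℤ) + 1) := ⟨_, rfl⟩
    have hπw : π w = n + 1 := by rw [hw]; simp
    have hwmem : w ∈ posSet (n + 1) := by rw [hw]; exact permOn_mem (permOn_inv hπ) hNmem
    have hwb := mem_pos.1 hwmem
    push_cast at hwb
    have hwn : w ≤ n := by
      rcases lt_or_eq_of_le hwb.2 with h | h
      · omega
      · rw [h] at hπw; exact absurd hπw hf
    -- `π` preserves `[u, n+1]`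
    have hI : ∀ a, u ≤ a → a ≤ n + 1 → u ≤ π a ∧ π a ≤ n + 1 := by
      have := hC (n + 1) (by omega) (by push_cast; omega) (by rw [← hu]; omega)
      rw [← hu] at this
      exact this
    have hIiff : ∀ a, (u ≤ a ∧ a ≤ n + 1) ↔ (u ≤ π a ∧ π a ≤ n + 1) := by
      intro a
      have := finite_inv π (Finset.Icc u ((n : ℤ) + 1)) (by
        intro b hb; rw [Finset.mem_Icc] at *; exact hI b hb.1 hb.2) a
      simpa [Finset.mem_Icc] using this
    have huw : u ≤ w := ((hIiff w).2 (by rw [hπw]; omega)).1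
    set π' := Equiv.swap u ((n : ℤ) + 1) * π with hπ'
    have hπ'N : π' ((n : ℤ) + 1) = n + 1 := by
      rw [hπ', Equiv.Perm.mul_apply, ← hu, Equiv.swap_apply_left]
    have hπ'w : π' w = u := by
      rw [hπ', Equiv.Perm.mul_apply, hπw, Equiv.swap_apply_right]
    have hπ'o : ∀ a, a ≠ w → a ≠ n + 1 → π' a = π a := by
      intro a h1 h2
      rw [hπ', Equiv.Perm.mul_apply, Equiv.swap_apply_of_ne_of_ne]
      · rw [hu]; intro h; exact h2 (π.injective h)
      · rw [← hπw]; intro h; exact h1 (π.injective h)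
    have hπ'P : IsPermOn π' (posSet (n + 1)) := permOn_mul (permOn_swap humem hNmem) hπ
    have hmain := fixcase π' hπ'P hπ'N (by
      intro v hv1 hv2 hle
      by_cases hvw : v = w
      · subst hvw
        rw [hπ'w]
        have hR : ∀ a ∈ Finset.Icc (v + 1) (n : ℤ), π a ∈ Finset.Icc (v + 1) (n : ℤ) := by
          intro a ha
          rw [Finset.mem_Icc] at *
          have h1 := hI a (by omega) (by omega)
          have h2 : π a ≠ n + 1 := by
            rw [← hπw]; intro h; have := π.injective h; omega
          by_contra hc
          have h3 := hC a (by omega) (by push_cast; omega) (by omega) v (by omega) (by omega)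
          omega
        intro a ha1 ha2
        by_cases hav : a = v
        · rw [hav, hπ'w]; omega
        rw [hπ'o a hav (by omega)]
        have h1 := hI a (by omega) (by omega)
        have h2 : π a ≠ n + 1 := by
          rw [← hπw]; intro h; exact hav (π.injective h)
        have h3 := finite_inv π _ hR a
        rw [Finset.mem_Icc, Finset.mem_Icc] at h3
        omega
      · rw [hπ'o v hvw (by omega)] at hle ⊢
        intro a ha1 ha2
        have h1 := hC v hv1 (by push_cast; omega) hle a ha1 ha2
        have haw : a ≠ w := by rintro rfl; omega
        rw [hπ'o a haw (by omega)]
        exact h1)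
    -- count of `π`
    have hc1 : cyclesOn π (posSet (n + 1)) + 1 = cyclesOn π' (posSet (n + 1)) := by
      have e : π = π' * Equiv.swap w ((n : ℤ) + 1) := by
        ext a
        rw [Equiv.Perm.mul_apply]
        by_cases h1 : a = w
        · rw [h1, Equiv.swap_apply_left, hπ'N, hπw]
        by_cases h2 : a = n + 1
        · rw [h2, Equiv.swap_apply_right, hπ'w, ← hu]
        rw [Equiv.swap_apply_of_ne_of_ne h1 h2, hπ'o a h1 h2]
      conv_lhs => rw [e]
      apply merge_count π' _ hπ'P _ _ hwmem hNmem
      intro hc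
      have := sc_fixed π' hπ'N hc.symm
      omega
    obtain ⟨z, hz⟩ : ∃ z : ℤ, z = if u = 1 then (n : ℤ) + 1 else u - 1 := ⟨_, rfl⟩
    have hzmem : z ∈ posSet (n + 1) := by rw [mem_pos, hz]; push_cast; split_ifs <;> omega
    have hγz : gammaZ (n + 1) z = u := by
      rw [hz]
      split_ifs with h
      · rw [h]; exact_mod_cast gamma_last (n + 1) (by omega)
      · rw [gamma_lt _ _ (by omega) (by push_cast; omega)]; ring
    have hγn : gammaZ (n + 1) n = n + 1 := gamma_lt _ _ (by omega) (by push_cast; omega)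
    have hnmem : (n : ℤ) ∈ posSet (n + 1) := by rw [mem_pos]; push_cast; omega
    have hγP := gamma_permOn (n + 1)
    have hc2 : cyclesOn (π'⁻¹ * gammaZ (n + 1)) (posSet (n + 1)) + 1 =
        cyclesOn (π⁻¹ * gammaZ (n + 1)) (posSet (n + 1)) := by
      have e : π'⁻¹ * gammaZ (n + 1) = (π⁻¹ * gammaZ (n + 1)) * Equiv.swap z n := by
        rw [hπ', mul_inv_rev, Equiv.swap_inv, mul_assoc, mul_assoc]
        congr 1
        rw [← hγz]
        conv_lhs => rw [← hγn]
        ext a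
        simp only [Equiv.Perm.mul_apply]
        rw [Equiv.swap_apply_apply]
        simp
      rw [e]
      apply merge_count _ _ (permOn_mul (permOn_inv hπ) hγP) _ _ hzmem hnmem
      intro hc
      have hinv := finite_inv (π⁻¹ * gammaZ (n + 1)) (Finset.Icc u n) (by
        intro a ha
        rw [Finset.mem_Icc] at *
        rw [Equiv.Perm.mul_apply, gamma_lt _ _ (by omega) (by push_cast; omega)]
        have h1 := hIiff (π⁻¹ (a + 1))
        rw [p_apply_inv] at h1
        have h2 : π⁻¹ (a + 1) ≠ n + 1 := by
          intro h; rw [Equiv.Perm.inv_eq_iff_eq, ← hu] at h; omega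
        omega)
      have := sc_invariant _ (fun a => a ∈ Finset.Icc u (n : ℤ)) hinv hc.symm
        (by simp only [Finset.mem_Icc]; omega)
      simp only [Finset.mem_Icc] at this
      split_ifs at hz <;> omega
    omega

theorem exists_crossing (n : ℕ) (hn : 1 ≤ n) (π : Equiv.Perm ℤ) (hπ : IsPermOn π (posSet n))
    (hne : cyclesOn π (posSet n) + cyclesOn (π⁻¹ * gammaZ n) (posSet n) ≠ n + 1) :
    ∃ u : ℤ, 1 ≤ u ∧ u < π⁻¹ u ∧ π⁻¹ u < n ∧
      ∃ a, u ≤ a ∧ a ≤ π⁻¹ u ∧ ¬ (u ≤ π a ∧ π a ≤ π⁻¹ u) := by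
  by_contra hcon
  push Not at hcon
  apply hne
  have main : ∀ v : ℤ, 1 ≤ v → v < n → π v ≤ v → ∀ a, π v ≤ a → a ≤ v →
      π v ≤ π a ∧ π a ≤ v := by
    intro v h1 h2 h3 a ha1 ha2
    rcases lt_or_eq_of_le h3 with h | h
    · have hm := mem_pos.1 (permOn_mem hπ (a := v) (mem_pos.2 ⟨h1, by omega⟩))
      have := hcon (π v) hm.1 (by simpa using h) (by simpa using h2) a ha1 (by simpa using ha2)
      simpa using this
    · have : a = v := by omega
      rw [this]; omega
  apply planar n hn π hπ
  intro v h1 h2 h3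
  rcases lt_or_eq_of_le h2 with h | h
  · exact main v h1 h h3
  -- the last point
  have hm := mem_pos.1 (permOn_mem hπ (a := v) (mem_pos.2 ⟨h1, by omega⟩))
  have hL : ∀ a ∈ Finset.Ico (π v) (v + 1), π a ∈ Finset.Ico (π v) (v + 1) := by
    have hinv := finite_inv π⁻¹ (Finset.Ico 1 (π v)) (by
      intro a ha
      rw [Finset.mem_Ico] at *
      have hb := mem_pos.1 (permOn_mem (permOn_inv hπ) (a := a) (mem_pos.2 ⟨by omega, by omega⟩))
      by_contra hc
      have hbv : π⁻¹ a ≠ v := by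
        intro he; rw [Equiv.Perm.inv_eq_iff_eq] at he; omega
      have := main (π⁻¹ a) (by omega) (by omega) (by rw [p_apply_inv]; omega)
      simp only [p_apply_inv] at this
      -- `π v` lies in `[a, π⁻¹ a]`; its preimage is outside
      have hfin := finite_inv π (Finset.Icc a (π⁻¹ a)) (by
        intro b hb; rw [Finset.mem_Icc] at *; exact this b hb.1 hb.2) v
      rw [Finset.mem_Icc, Finset.mem_Icc] at hfin
      omega)
    intro a ha
    have h4 := hinv (π a)
    rw [p_inv_apply] at h4
    rw [Finset.mem_Ico] at *
    rw [Finset.mem_Ico] at h4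
    have hb := mem_pos.1 (permOn_mem hπ (a := a) (mem_pos.2 ⟨by omega, by omega⟩))
    omega
  intro a ha1 ha2
  have := hL a (by rw [Finset.mem_Ico]; omega)
  rw [Finset.mem_Ico] at this
  omega

theorem exists_good (n : ℕ) (hn : 1 ≤ n) (π : Equiv.Perm ℤ) (hπ : IsPermOn π (posSet n))
    (hne : cyclesOn π (posSet n) + cyclesOn (π⁻¹ * gammaZ n) (posSet n) ≠ n + 1) :
    ∃ u : ℤ, 1 ≤ u ∧ u < π⁻¹ u ∧ π⁻¹ u < n ∧
      (∃ a, u ≤ a ∧ a ≤ π⁻¹ u ∧ ¬ (u ≤ π a ∧ π a ≤ π⁻¹ u)) ∧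
      ∀ a : ℤ, 1 ≤ a → a < u → ¬ (u ≤ π⁻¹ a ∧ π⁻¹ a ≤ π⁻¹ u) := by
  classical
  have hex : ∃ k : ℕ, 1 ≤ (k : ℤ) ∧ (k : ℤ) < π⁻¹ k ∧ π⁻¹ k < n ∧
      ∃ a, (k : ℤ) ≤ a ∧ a ≤ π⁻¹ k ∧ ¬ ((k : ℤ) ≤ π a ∧ π a ≤ π⁻¹ k) := by
    obtain ⟨u, h1, h2⟩ := exists_crossing n hn π hπ hne
    obtain ⟨k, rfl⟩ := Int.eq_ofNat_of_zero_le (show 0 ≤ u by omega)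
    exact ⟨k, h1, h2⟩
  obtain ⟨h1, h2, h3, h4⟩ := Nat.find_spec hex
  have hmin := fun k => Nat.find_min hex (m := k)
  generalize Nat.find hex = u at *
  refine ⟨u, h1, h2, h3, h4, ?_⟩
  intro a ha1 ha2 hb
  obtain ⟨k, rfl⟩ := Int.eq_ofNat_of_zero_le (show 0 ≤ a by omega)
  apply hmin k (by omega)
  have hne' : π⁻¹ (k : ℤ) ≠ π⁻¹ (u : ℤ) := by
    intro h; have := (π⁻¹).injective h; omega
  refine ⟨ha1, by omega, by omega, ?_⟩
  by_contra hc
  push Not at hc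
  have hfin := finite_inv π (Finset.Icc (k : ℤ) (π⁻¹ k)) (by
    intro b hb; rw [Finset.mem_Icc] at *; exact hc b hb.1 hb.2) (π⁻¹ u)
  rw [p_apply_inv, Finset.mem_Icc, Finset.mem_Icc] at hfin
  omega

/-- The basic facts about `γ_{n,u,v}`. -/
theorem uv_facts (n : ℕ) (u v : ℤ) (hu : 1 ≤ u) (huv : u < v) (hv : v < n) :
    ∃ z : ℤ, z ∈ posSet n ∧ gammaZ n z = u ∧ z ≠ v ∧ ¬ (u ≤ z ∧ z ≤ v) ∧
      gammaUV n u v = gammaZ n * Equiv.swap z v ∧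
      IsPermOn (gammaUV n u v) (posSet n) ∧
      gammaZ n = gammaUV n u v * Equiv.swap z v ∧
      ∀ a, (u ≤ a ∧ a ≤ v) ↔ (u ≤ gammaUV n u v a ∧ gammaUV n u v a ≤ v) := by
  obtain ⟨z, hz⟩ : ∃ z : ℤ, z = if u = 1 then (n : ℤ) else u - 1 := ⟨_, rfl⟩
  have hzmem : z ∈ posSet n := by rw [mem_pos, hz]; split_ifs <;> omega
  have hvmem : v ∈ posSet n := by rw [mem_pos]; omega
  have hγz : gammaZ n z = u := by
    rw [hz]
    split_ifs with h
    · rw [h]; exact gamma_last n (by omega)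
    · rw [gamma_lt _ _ (by omega) (by omega)]; ring
  have hout : ¬ (u ≤ z ∧ z ≤ v) := by split_ifs at hz <;> omega
  have hdef : gammaUV n u v = gammaZ n * Equiv.swap z v := by rw [gammaUV, hz]
  refine ⟨z, hzmem, hγz, by rintro rfl; omega, hout, hdef, ?_, ?_, ?_⟩
  · rw [hdef]; exact permOn_mul (gamma_permOn n) (permOn_swap hzmem hvmem)
  · rw [hdef, mul_assoc, Equiv.swap_mul_self, mul_one]
  · intro a
    have := finite_inv (gammaUV n u v) (Finset.Icc u v) (by
      intro b hb
      rw [Finset.mem_Icc] at *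
      rw [hdef, Equiv.Perm.mul_apply]
      by_cases hbv : b = v
      · rw [hbv, Equiv.swap_apply_right, hγz]; omega
      · rw [Equiv.swap_apply_of_ne_of_ne (by rintro rfl; exact hout hb) hbv,
          gamma_lt _ _ (by omega) (by omega)]
        omega) a
    simpa [Finset.mem_Icc] using this

theorem uv_count (n : ℕ) (u v : ℤ) (hu : 1 ≤ u) (huv : u < v) (hv : v < n)
    (π : Equiv.Perm ℤ) (hπ : IsPermOn π (posSet n)) (hπu : π⁻¹ u = v) :
    cyclesOn (gammaUV n u v) (posSet n) = 2 ∧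
    cyclesOn (π⁻¹ * gammaUV n u v) (posSet n) = cyclesOn (π⁻¹ * gammaZ n) (posSet n) + 1 := by
  obtain ⟨z, hzmem, hγz, hzv, hout, hdef, hP, hback, hinv⟩ := uv_facts n u v hu huv hv
  have hvmem : v ∈ posSet n := by rw [mem_pos]; omega
  constructor
  · have := merge_count _ _ hP z v hzmem hvmem (by
      intro hc
      exact hout (sc_invariant _ (fun a => u ≤ a ∧ a ≤ v) hinv hc.symm (by omega)))
    rw [← hback, gamma_cycles n (by omega)] at this
    omega
  · have hfix : (π⁻¹ * gammaUV n u v) v = v := by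
      rw [hdef, Equiv.Perm.mul_apply, Equiv.Perm.mul_apply, Equiv.swap_apply_right, hγz, hπu]
    have := merge_count (π⁻¹ * gammaUV n u v) _ (permOn_mul (permOn_inv hπ) hP) z v hzmem hvmem (by
      intro hc
      exact hzv (sc_fixed _ hfix hc.symm).symm)
    rw [mul_assoc, ← hback] at this
    omega

theorem uv_trans (n : ℕ) (u v : ℤ) (hu : 1 ≤ u) (huv : u < v) (hv : v < n)
    (π : Equiv.Perm ℤ) (hπ : IsPermOn π (posSet n))
    (hcross : ∃ a, u ≤ a ∧ a ≤ v ∧ ¬ (u ≤ π a ∧ π a ≤ v)) :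
    ∀ a ∈ posSet n, ∀ b ∈ posSet n,
      ∃ σ ∈ Subgroup.closure ({π, gammaUV n u v} : Set (Equiv.Perm ℤ)), σ a = b := by
  obtain ⟨z, hzmem, hγz, hzv, hout, hdef, hP, hback, hinv⟩ := uv_facts n u v hu huv hv
  have hvmem : v ∈ posSet n := by rw [mem_pos]; omega
  set G := Subgroup.closure ({π, gammaUV n u v} : Set (Equiv.Perm ℤ)) with hG
  have hnsc : ¬ (gammaUV n u v).SameCycle z v := by
    intro hc
    exact hout (sc_invariant _ (fun a => u ≤ a ∧ a ≤ v) hinv hc.symm (by omega))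
  have hall : ∀ a ∈ posSet n, (gammaZ n).SameCycle z a := by
    intro a ha
    have h1 := gamma_cycles n (by omega)
    rw [cyclesOn, Set.ncard_eq_one] at h1
    obtain ⟨C, hC⟩ := h1
    have e1 : {b | (gammaZ n).SameCycle z b} ∈ ({C} : Set (Set ℤ)) := by
      rw [← hC]; exact ⟨z, hzmem, rfl⟩
    have e2 : {b | (gammaZ n).SameCycle a b} ∈ ({C} : Set (Set ℤ)) := by
      rw [← hC]; exact ⟨a, ha, rfl⟩
    exact (cyc_class_eq _ _ _).1 (e1.trans e2.symm)
  have htwo : ∀ a ∈ posSet n, (gammaUV n u v).SameCycle a z ∨ (gammaUV n u v).SameCycle a v := by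
    intro a ha
    have := hall a ha
    rw [hback] at this
    exact (merge_iff _ _ hP z v a hnsc).1 this
  have hRγ : ∀ a b, (gammaUV n u v).SameCycle a b → ∃ σ ∈ G, σ a = b := by
    rintro a b ⟨i, hi⟩
    exact ⟨_, G.zpow_mem (Subgroup.subset_closure (by simp)) i, hi⟩
  have hRs : ∀ a b, (∃ σ ∈ G, σ a = b) → ∃ σ ∈ G, σ b = a := by
    rintro a b ⟨σ, hσ, rfl⟩
    exact ⟨σ⁻¹, G.inv_mem hσ, by simp⟩
  have hRt : ∀ a b c, (∃ σ ∈ G, σ a = b) → (∃ σ ∈ G, σ b = c) → ∃ σ ∈ G, σ a = c := by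
    rintro a b c ⟨σ, hσ, rfl⟩ ⟨τ, hτ, rfl⟩
    exact ⟨τ * σ, G.mul_mem hτ hσ, by simp⟩
  have hvz : ∃ σ ∈ G, σ v = z := by
    obtain ⟨a, ha1, ha2, hna⟩ := hcross
    have hamem : a ∈ posSet n := by rw [mem_pos]; omega
    have hav : (gammaUV n u v).SameCycle a v := by
      rcases htwo a hamem with h | h
      · exact absurd (sc_invariant _ (fun a => u ≤ a ∧ a ≤ v) hinv h ⟨ha1, ha2⟩) hout
      · exact h
    have hbz : (gammaUV n u v).SameCycle (π a) z := by
      rcases htwo (π a) (permOn_mem hπ hamem) with h | h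
      · exact h
      · exact absurd (sc_invariant _ (fun a => u ≤ a ∧ a ≤ v) hinv h.symm (by omega)) hna
    exact hRt _ _ _ (hRγ _ _ hav.symm) (hRt _ _ _
      ⟨π, Subgroup.subset_closure (by simp), rfl⟩ (hRγ _ _ hbz))
  have hz : ∀ a ∈ posSet n, ∃ σ ∈ G, σ a = z := by
    intro a ha
    rcases htwo a ha with h | h
    · exact hRγ _ _ h
    · exact hRt _ _ _ (hRγ _ _ h) hvz
  intro a ha b hb
  exact hRt _ _ _ (hz a ha) (hRs _ _ (hz b hb))

/-- For `n ≥ 1` and `p ∈ [n]`, `â_{1,p}(n) = NC^{T,p}(n)` as subsets of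
`S_{[n]}`. -/
theorem aHat1_eq_ncTPerm (n p : ℕ) (hn : 1 ≤ n) (hp1 : 1 ≤ p) (hpn : p ≤ n) :
    aHatSet 1 p n = ncTPerm p n := by
  have hcard : (posSet n).card = n := by simp [posSet]
  ext π
  constructor
  · rintro ⟨hπ, hc, he⟩
    obtain ⟨u, h1, h2, h3, h4, h5⟩ := exists_good n hn π hπ (by omega)
    obtain ⟨c1, c2⟩ := uv_count n u (π⁻¹ u) h1 h2 h3 π hπ rfl
    refine ⟨u, π⁻¹ u, h1, h2, h3, hπ, ⟨uv_trans n u _ h1 h2 h3 π hπ h4, ?_⟩, rfl, hc, ?_⟩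
    · rw [hcard]; omega
    · intro a ha1 ha2
      exact ⟨permOn_mem (permOn_inv hπ) (mem_pos.2 ⟨ha1, by omega⟩), h5 a ha1 ha2⟩
  · rintro ⟨u, v, h1, h2, h3, hπ, ⟨-, hs⟩, huv, hc, -⟩
    obtain ⟨c1, c2⟩ := uv_count n u v h1 h2 h3 π hπ huv
    rw [hcard] at hs
    exact ⟨hπ, hc, by omega⟩

end RibbonNC
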